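/- Let m ∈ (1/2)ℤ_{>0}, and let s, s₁ ∈ (1/2)ℤ be such that s − s₁ ∈ ℤ. Then Φ̃^{±[m;s]} = Φ̃^{±[m;s₁]}, i.e. for every τ with Im τ > 0 and all z₁, z₂ ∈ ℂ with z₁ ∉ ℤ + ℤτ one has Φ̃^{±[m;s]}(τ, z₁, z₂) = Φ̃^{±[m;s₁]}(τ, z₁, z₂). -/

import Mathlib

noncomputable section

open Complex

/-- `mexp w = e^{2πi w}`. -/
def mexp (w : ℂ) : ℂ := Complex.exp (2 * (Real.pi : ℂ) * Complex.I * w)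

/-- The signed mock theta function `Φ^{sgn[m;s]}(τ,z₁,z₂)`. -/
def PhiS (sgn : ℂ) (m s : ℝ) (τ z₁ z₂ : ℂ) : ℂ :=
  ∑' n : ℤ, sgn ^ n *
    mexp ((m : ℂ) * n * (z₁ + z₂) + (s : ℂ) * z₁ + τ * ((m : ℂ) * n ^ 2 + (s : ℂ) * n)) /
    (1 - mexp (z₁ + n * τ))

/-- The signed theta function `Θ^{sgn}_{j,m}(τ,z)`. -/
def ThetaS (sgn : ℂ) (j m : ℝ) (τ z : ℂ) : ℂ :=
  ∑' n : ℤ, sgn ^ n *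
    mexp ((m : ℂ) * z * ((n : ℂ) + ((j / (2 * m) : ℝ) : ℂ)) +
      τ * (m : ℂ) * ((n : ℂ) + ((j / (2 * m) : ℝ) : ℂ)) ^ 2)

/-- `E(x) = 2∫₀ˣ e^{-πu²} du`. -/
def Efun (x : ℝ) : ℝ := 2 * ∫ u in (0:ℝ)..x, Real.exp (-Real.pi * u ^ 2)

/-- `ψ_{m,n}(τ,z) = (n - 2m Im z / Im τ) √(Im τ / m)`. -/
def psiMN (m n : ℝ) (τ z : ℂ) : ℝ := (n - 2 * m * z.im / τ.im) * Real.sqrt (τ.im / m)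

/-- The real-analytic correction `R^{sgn}_{j,m}(τ,z)`; the summation variable `n ∈ j + 2mℤ`
is written as `n = j + 2mk`, `k ∈ ℤ`, so that `(±1)^{(n-j)/(2m)} = sgn^k`. -/
def RS (sgn : ℂ) (j m : ℝ) (τ z : ℂ) : ℂ :=
  ∑' k : ℤ, sgn ^ k *
    (((Real.sign (j + 2 * m * k - 1 / 2 - j + 2 * m) -
        Efun (psiMN m (j + 2 * m * k) τ z) : ℝ)) : ℂ) *
    Complex.exp (-(Real.pi : ℂ) * Complex.I * (((j + 2 * m * k : ℝ)) : ℂ) ^ 2 * τ / (2 * (m : ℂ))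
      + 2 * (Real.pi : ℂ) * Complex.I * (((j + 2 * m * k : ℝ)) : ℂ) * z)

/-- The modifier `Φ^{sgn[m;s]}_add`; the summation variable `j ∈ s + ℤ`, `s ≤ j < s + 2m`
is written as `j = s + i`, `0 ≤ i < ⌈2m⌉`. -/
def PhiAddS (sgn : ℂ) (m s : ℝ) (τ z₁ z₂ : ℂ) : ℂ :=
  ∑ i ∈ Finset.range ⌈2 * m⌉₊,
    RS sgn (s + i) m τ ((z₁ - z₂) / 2) * ThetaS sgn (s + i) m τ (z₁ + z₂)

/-- The modified (signed) mock theta function `Φ̃^{sgn[m;s]}`. -/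
def PhiTilde (sgn : ℂ) (m s : ℝ) (τ z₁ z₂ : ℂ) : ℂ :=
  PhiS sgn m s τ z₁ z₂ - (1 / 2) * PhiAddS sgn m s τ z₁ z₂

end

noncomputable section

open Complex Filter MeasureTheory

lemma summable_exp_quadratic {a : ℝ} (ha : 0 < a) (b c : ℝ) :
    Summable fun k : ℤ => Real.exp (-a * k ^ 2 + b * k + c) := by
  have h := (summable_jacobiTheta₂_term_iff (-(b / (2 * Real.pi)) * I) ((a / Real.pi) * I)).2
    (by simpa using (by norm_cast; positivity : 0 < ((a : ℂ) / Real.pi).re))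
  refine (h.norm.mul_right (Real.exp c)).congr fun k => ?_
  rw [jacobiTheta₂_term, Complex.norm_exp, ← Real.exp_add]
  congr 1
  have hpi : (Real.pi : ℂ) ≠ 0 := by exact_mod_cast Real.pi_ne_zero
  have : 2 * (Real.pi : ℂ) * I * k * (-(b / (2 * Real.pi)) * I) +
      Real.pi * I * k ^ 2 * ((a / Real.pi) * I) = ((-a * k ^ 2 + b * k : ℝ) : ℂ) := by
    push_cast
    field_simp
    rw [I_sq]
    ring
  rw [this, ofReal_re]

lemma tendsto_add_mul_int_atTop (c : ℝ) {d : ℝ} (hd : 0 < d) :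
    Tendsto (fun k : ℤ => c + d * k) atTop atTop :=
  tendsto_atTop_add_const_left _ _ (tendsto_intCast_atTop_atTop.const_mul_atTop hd)

lemma tendsto_add_mul_int_atBot (c : ℝ) {d : ℝ} (hd : 0 < d) :
    Tendsto (fun k : ℤ => c + d * k) atBot atBot :=
  tendsto_atBot_add_const_left _ _ ((tendsto_intCast_atBot_iff.2 tendsto_id).const_mul_atBot hd)

lemma Efun_neg (x : ℝ) : Efun (-x) = -Efun x := by
  have h := intervalIntegral.integral_comp_neg (a := 0) (b := x)
    (fun u : ℝ => Real.exp (-Real.pi * u ^ 2))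
  rw [Efun, intervalIntegral.integral_symm]
  simp only [neg_sq, neg_zero] at h
  rw [Efun, h]
  ring

lemma abs_one_sub_Efun_le {x : ℝ} (hx : 0 ≤ x) :
    |1 - Efun x| ≤ Real.exp (-Real.pi * x ^ 2) := by
  set f : ℝ → ℝ := fun u => Real.exp (-Real.pi * u ^ 2) with hf
  have hint : Integrable f := integrable_exp_neg_mul_sq Real.pi_pos
  have hhalf : ∫ u in Set.Ioi (0 : ℝ), f u = 1 / 2 := by
    rw [hf, integral_gaussian_Ioi, div_self Real.pi_ne_zero, Real.sqrt_one]
  have hsplit := intervalIntegral.integral_interval_add_Ioi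
    (hint.integrableOn (s := Set.Ioi 0)) (hint.integrableOn (s := Set.Ioi x))
  have htail : 1 - Efun x = 2 * ∫ u in Set.Ioi x, f u := by
    rw [Efun]
    linarith
  have hshift : ∫ u in Set.Ioi x, f u = ∫ t in Set.Ioi (0 : ℝ), f (t + x) := by
    rw [← (measurePreserving_add_right volume x).setIntegral_preimage_emb
      (measurableEmbedding_addRight x) f (Set.Ioi x)]
    simp
  have hle : ∫ t in Set.Ioi (0 : ℝ), f (t + x) ≤
      ∫ t in Set.Ioi (0 : ℝ), Real.exp (-Real.pi * x ^ 2) * f t := by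
    refine setIntegral_mono_on (hint.comp_add_right x).integrableOn
      (hint.const_mul _).integrableOn measurableSet_Ioi fun t ht => ?_
    rw [hf, ← Real.exp_add, Real.exp_le_exp]
    have : 0 ≤ Real.pi * (t * x) :=
      mul_nonneg Real.pi_pos.le (mul_nonneg (le_of_lt ht) hx)
    nlinarith
  rw [integral_const_mul, hhalf] at hle
  have hnonneg : 0 ≤ ∫ u in Set.Ioi x, f u := integral_nonneg fun u => (Real.exp_pos _).le
  rw [htail, abs_of_nonneg (by positivity), hshift]
  linarith

lemma abs_neg_one_sub_Efun_le {x : ℝ} (hx : x ≤ 0) :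
    |-1 - Efun x| ≤ Real.exp (-Real.pi * x ^ 2) := by
  have h := abs_one_sub_Efun_le (neg_nonneg.2 hx)
  rwa [Efun_neg, neg_sq, ← abs_neg, show -(1 - -Efun x) = -1 - Efun x by ring] at h

lemma norm_zpow_sign {sgn : ℂ} (hsgn : sgn = 1 ∨ sgn = -1) (k : ℤ) : ‖sgn ^ k‖ = 1 := by
  rcases hsgn with rfl | rfl <;> simp

/-- The exponential factor of the term of index `n` in `RS`. -/
def rExp (m n : ℝ) (τ z : ℂ) : ℂ :=
  Complex.exp (-(Real.pi : ℂ) * Complex.I * (n : ℂ) ^ 2 * τ / (2 * (m : ℂ))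
    + 2 * (Real.pi : ℂ) * Complex.I * (n : ℂ) * z)

lemma exp_psi_mul_norm_rExp {m : ℝ} (hm : 0 < m) (n : ℝ) {τ : ℂ} (hτ : 0 < τ.im) (z : ℂ) :
    Real.exp (-Real.pi * psiMN m n τ z ^ 2) * ‖rExp m n τ z‖ =
      Real.exp (-(Real.pi * τ.im / (2 * m)) * n ^ 2 + 2 * Real.pi * z.im * n
        - 4 * Real.pi * m * z.im ^ 2 / τ.im) := by
  have hre : (-(Real.pi : ℂ) * I * (n : ℂ) ^ 2 * τ / (2 * (m : ℂ))
      + 2 * (Real.pi : ℂ) * I * (n : ℂ) * z).re =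
      Real.pi * n ^ 2 * τ.im / (2 * m) - 2 * Real.pi * n * z.im := by
    have h1 : -(Real.pi : ℂ) * I * (n : ℂ) ^ 2 * τ / (2 * (m : ℂ))
        + 2 * (Real.pi : ℂ) * I * (n : ℂ) * z =
        ((-(Real.pi * n ^ 2 / (2 * m)) : ℝ) : ℂ) * (I * τ)
          + ((2 * Real.pi * n : ℝ) : ℂ) * (I * z) := by
      push_cast
      ring
    rw [h1, add_re, re_ofReal_mul, re_ofReal_mul, I_mul_re, I_mul_re]
    ring
  rw [rExp, Complex.norm_exp, ← Real.exp_add, hre, psiMN, mul_pow,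
    Real.sq_sqrt (div_pos hτ hm).le]
  congr 1
  field_simp
  ring

lemma sign_intCast_mul_add {d : ℝ} (hd : 1 ≤ d) (k : ℤ) :
    Real.sign (d * k - 1 / 2 + d) = if 0 ≤ k then 1 else -1 := by
  split_ifs with hk
  · have : (0 : ℝ) ≤ k := by exact_mod_cast hk
    exact Real.sign_of_pos (by nlinarith)
  · have : (k : ℝ) ≤ -1 := by exact_mod_cast (by omega : k ≤ -1)
    exact Real.sign_of_neg (by nlinarith)

/-- The term of index `n = j + 2mk` in `RS`, with the sign factor left free. -/
def rTerm (sgn : ℂ) (ε : ℝ) (j m : ℝ) (τ z : ℂ) (k : ℤ) : ℂ :=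
  sgn ^ k * ((ε - Efun (psiMN m (j + 2 * m * k) τ z) : ℝ) : ℂ) * rExp m (j + 2 * m * k) τ z

lemma RS_eq_tsum (sgn : ℂ) (j : ℝ) {m : ℝ} (hm : 1 ≤ 2 * m) (τ z : ℂ) :
    RS sgn j m τ z = ∑' k : ℤ, rTerm sgn (if 0 ≤ k then 1 else -1) j m τ z k := by
  refine tsum_congr fun k => ?_
  rw [rTerm, rExp, ← sign_intCast_mul_add hm k,
    show j + 2 * m * k - 1 / 2 - j + 2 * m = 2 * m * k - 1 / 2 + 2 * m by ring]

lemma summable_rTerm {sgn : ℂ} (hsgn : sgn = 1 ∨ sgn = -1) (j : ℝ) {m : ℝ} (hm : 0 < m)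
    {τ : ℂ} (hτ : 0 < τ.im) (z : ℂ) :
    Summable fun k : ℤ => rTerm sgn (if 0 ≤ k then 1 else -1) j m τ z k := by
  have hsum := summable_exp_quadratic (a := 2 * Real.pi * m * τ.im)
    (by have := Real.pi_pos; positivity)
    (-(2 * Real.pi * τ.im * j) + 4 * Real.pi * m * z.im)
    (-(Real.pi * τ.im / (2 * m)) * j ^ 2 + 2 * Real.pi * z.im * j
      - 4 * Real.pi * m * z.im ^ 2 / τ.im)
  have hpsi : ∀ k : ℤ, psiMN m (j + 2 * m * k) τ z =
      (j - 2 * m * z.im / τ.im) * Real.sqrt (τ.im / m)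
        + 2 * m * Real.sqrt (τ.im / m) * k := fun k => by
    rw [psiMN]
    ring
  have hd : 0 < 2 * m * Real.sqrt (τ.im / m) := by
    have := Real.sqrt_pos.2 (div_pos hτ hm)
    positivity
  refine hsum.of_norm_bounded_eventually ?_
  have key : ∀ᶠ k : ℤ in cofinite,
      |(if 0 ≤ k then (1 : ℝ) else -1) - Efun (psiMN m (j + 2 * m * k) τ z)| ≤
        Real.exp (-Real.pi * psiMN m (j + 2 * m * k) τ z ^ 2) := by
    rw [Int.cofinite_eq, eventually_sup]
    constructor
    · filter_upwards [eventually_le_atBot (-1 : ℤ),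
        (tendsto_add_mul_int_atBot _ hd).eventually_le_atBot 0] with k hk hk'
      rw [if_neg (by omega)]
      exact abs_neg_one_sub_Efun_le (by rw [hpsi]; exact hk')
    · filter_upwards [eventually_ge_atTop (0 : ℤ),
        (tendsto_add_mul_int_atTop _ hd).eventually_ge_atTop 0] with k hk hk'
      rw [if_pos hk]
      exact abs_one_sub_Efun_le (by rw [hpsi]; exact hk')
  filter_upwards [key] with k hk
  rw [rTerm, norm_mul, norm_mul, norm_zpow_sign hsgn, one_mul, Complex.norm_real,
    Real.norm_eq_abs]
  refine (mul_le_mul_of_nonneg_right hk (norm_nonneg _)).trans_eq ?_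
  rw [exp_psi_mul_norm_rExp hm _ hτ]
  congr 1
  field_simp
  ring

lemma sgn_mul_self {sgn : ℂ} (hsgn : sgn = 1 ∨ sgn = -1) : sgn * sgn = 1 := by
  rcases hsgn with rfl | rfl <;> simp

lemma sgn_zpow_add_one {sgn : ℂ} (hsgn : sgn = 1 ∨ sgn = -1) (k : ℤ) :
    sgn ^ (k + 1) = sgn * sgn ^ k := by
  rw [zpow_add_one₀ (by rcases hsgn with rfl | rfl <;> simp), mul_comm]

lemma ThetaS_add_two_mul {sgn : ℂ} (hsgn : sgn = 1 ∨ sgn = -1) (j : ℝ) {m : ℝ} (hm : 0 < m)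
    (τ z : ℂ) : ThetaS sgn (j + 2 * m) m τ z = sgn * ThetaS sgn j m τ z := by
  rw [ThetaS, ThetaS, ← tsum_mul_left, eq_comm, ← (Equiv.addRight (1 : ℤ)).tsum_eq]
  refine tsum_congr fun n => ?_
  have hj : (j + 2 * m) / (2 * m) = j / (2 * m) + 1 := by field_simp
  simp only [Equiv.coe_addRight]
  rw [sgn_zpow_add_one hsgn, ← mul_assoc, ← mul_assoc, sgn_mul_self hsgn, one_mul, hj]
  push_cast
  ring_nf

lemma RS_add_two_mul {sgn : ℂ} (hsgn : sgn = 1 ∨ sgn = -1) (j : ℝ) {m : ℝ} (hm : 1 ≤ 2 * m)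
    {τ : ℂ} (hτ : 0 < τ.im) (z : ℂ) :
    RS sgn (j + 2 * m) m τ z = sgn * (RS sgn j m τ z - 2 * rExp m j τ z) := by
  have hshift : RS sgn (j + 2 * m) m τ z =
      sgn * ∑' k : ℤ, rTerm sgn (if 0 < k then 1 else -1) j m τ z k := by
    rw [RS_eq_tsum sgn _ hm, ← tsum_mul_left, eq_comm,
      ← (Equiv.addRight (1 : ℤ)).tsum_eq]
    refine tsum_congr fun k => ?_
    have hj : j + 2 * m + 2 * m * k = j + 2 * m * ((k + 1 : ℤ) : ℝ) := by
      push_cast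
      ring
    simp only [Equiv.coe_addRight]
    rw [rTerm, rTerm, hj, sgn_zpow_add_one hsgn, ← mul_assoc, ← mul_assoc,
      ← mul_assoc, sgn_mul_self hsgn, one_mul]
    simp only [Int.lt_add_one_iff]
  have hsum := (summable_rTerm hsgn j (m := m) (by linarith) hτ z).hasSum.sub
    (hasSum_ite_eq (0 : ℤ) (2 * rExp m j τ z))
  rw [hshift, RS_eq_tsum sgn j hm, ← hsum.tsum_eq]
  congr 1
  refine tsum_congr fun k => ?_
  rcases lt_trichotomy k 0 with hk | rfl | hk
  · simp [hk.not_ge, hk.not_gt, hk.ne]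
  · simp [rTerm]
    ring
  · simp [hk, hk.le, hk.ne']

lemma PhiAddS_sub {sgn : ℂ} (hsgn : sgn = 1 ∨ sgn = -1) {m : ℝ} {N : ℕ} (hN : 2 * m = N)
    (hN0 : 0 < N) (s : ℝ) {τ : ℂ} (hτ : 0 < τ.im) (z₁ z₂ : ℂ) :
    PhiAddS sgn m s τ z₁ z₂ - PhiAddS sgn m (s + 1) τ z₁ z₂ =
      2 * rExp m s τ ((z₁ - z₂) / 2) * ThetaS sgn s m τ (z₁ + z₂) := by
  have hm : 1 ≤ 2 * m := by
    rw [hN]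
    exact_mod_cast hN0
  set g : ℕ → ℂ := fun i =>
    RS sgn (s + i) m τ ((z₁ - z₂) / 2) * ThetaS sgn (s + i) m τ (z₁ + z₂) with hg
  have h1 : PhiAddS sgn m (s + 1) τ z₁ z₂ = ∑ i ∈ Finset.range N, g (i + 1) := by
    rw [PhiAddS, hN, Nat.ceil_natCast]
    refine Finset.sum_congr rfl fun i _ => ?_
    rw [hg]
    push_cast
    rw [show s + 1 + (i : ℝ) = s + (i + 1) by ring]
  have h0 : PhiAddS sgn m s τ z₁ z₂ = ∑ i ∈ Finset.range N, g i := by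
    rw [PhiAddS, hN, Nat.ceil_natCast]
  rw [h0, h1, ← Finset.sum_sub_distrib, Finset.sum_range_sub']
  simp only [hg, ← hN, Nat.cast_zero, add_zero]
  rw [RS_add_two_mul hsgn s hm hτ, ThetaS_add_two_mul hsgn s (by linarith)]
  linear_combination (-(RS sgn s m τ ((z₁ - z₂) / 2) - 2 * rExp m s τ ((z₁ - z₂) / 2)) *
    ThetaS sgn s m τ (z₁ + z₂)) * sgn_mul_self hsgn

lemma norm_mexp (w : ℂ) : ‖mexp w‖ = Real.exp (-(2 * Real.pi * w.im)) := by
  rw [mexp, Complex.norm_exp, show 2 * (Real.pi : ℂ) * I * w = ((2 * Real.pi : ℝ) : ℂ) * (I * w) by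
    push_cast; ring, re_ofReal_mul, I_mul_re]
  congr 1
  ring

lemma mexp_add (v w : ℂ) : mexp (v + w) = mexp v * mexp w := by
  rw [mexp, mexp, mexp, ← Complex.exp_add]
  congr 1
  ring

lemma mexp_ne_one {w : ℂ} (hw : ∀ a : ℤ, w ≠ a) : mexp w ≠ 1 := by
  intro h
  obtain ⟨a, ha⟩ := Complex.exp_eq_one_iff.1 h
  refine hw a (mul_left_cancel₀ Complex.two_pi_I_ne_zero ?_)
  rw [ha, mul_comm]

lemma eventually_half_le_norm_one_sub_mexp (z : ℂ) {τ : ℂ} (hτ : 0 < τ.im) :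
    ∀ᶠ n : ℤ in cofinite, 1 / 2 ≤ ‖1 - mexp (z + n * τ)‖ := by
  have hd : 0 < 2 * Real.pi * τ.im := by
    have := Real.pi_pos
    positivity
  have hnorm : ∀ n : ℤ, ‖mexp (z + n * τ)‖ =
      Real.exp (-(2 * Real.pi * z.im + 2 * Real.pi * τ.im * n)) := fun n => by
    rw [norm_mexp]
    simp only [add_im, mul_im, intCast_re, intCast_im, zero_mul, add_zero]
    ring_nf
  rw [Int.cofinite_eq, eventually_sup]
  constructor
  · have h := Real.tendsto_exp_atTop.comp (tendsto_neg_atBot_atTop.comp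
      (tendsto_add_mul_int_atBot (2 * Real.pi * z.im) hd))
    filter_upwards [h.eventually_ge_atTop 2] with n hn
    have h2 : 2 ≤ ‖mexp (z + n * τ)‖ := by
      rw [hnorm]
      exact hn
    have := norm_sub_norm_le (mexp (z + n * τ)) 1
    rw [norm_one, norm_sub_rev] at this
    linarith
  · have h := Real.tendsto_exp_atBot.comp (tendsto_neg_atTop_atBot.comp
      (tendsto_add_mul_int_atTop (2 * Real.pi * z.im) hd))
    filter_upwards [h.eventually_le_const (by norm_num : (0 : ℝ) < 1 / 2)] with n hn
    have h2 : ‖mexp (z + n * τ)‖ ≤ 1 / 2 := by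
      rw [hnorm]
      exact hn
    have := norm_sub_norm_le 1 (mexp (z + n * τ))
    rw [norm_one] at this
    linarith

lemma summable_PhiS_term {sgn : ℂ} (hsgn : sgn = 1 ∨ sgn = -1) {m : ℝ} (hm : 0 < m) (s : ℝ)
    {τ : ℂ} (hτ : 0 < τ.im) (z₁ z₂ : ℂ) :
    Summable fun n : ℤ => sgn ^ n *
      mexp ((m : ℂ) * n * (z₁ + z₂) + (s : ℂ) * z₁ + τ * ((m : ℂ) * n ^ 2 + (s : ℂ) * n)) /
      (1 - mexp (z₁ + n * τ)) := by
  have hsum := (summable_exp_quadratic (a := 2 * Real.pi * m * τ.im)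
    (by have := Real.pi_pos; positivity)
    (-(2 * Real.pi * (m * (z₁ + z₂).im + s * τ.im))) (-(2 * Real.pi * (s * z₁.im)))).mul_right 2
  refine hsum.of_norm_bounded_eventually ?_
  filter_upwards [eventually_half_le_norm_one_sub_mexp z₁ hτ] with n hn
  have him : ((m : ℂ) * n * (z₁ + z₂) + (s : ℂ) * z₁ +
      τ * ((m : ℂ) * n ^ 2 + (s : ℂ) * n)).im =
      m * n * (z₁ + z₂).im + s * z₁.im + (m * n ^ 2 + s * n) * τ.im := by
    rw [show (m : ℂ) * n * (z₁ + z₂) + (s : ℂ) * z₁ + τ * ((m : ℂ) * n ^ 2 + (s : ℂ) * n) =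
      ((m * n : ℝ) : ℂ) * (z₁ + z₂) + (s : ℂ) * z₁ + ((m * n ^ 2 + s * n : ℝ) : ℂ) * τ by
        push_cast; ring, Complex.add_im, Complex.add_im, im_ofReal_mul, im_ofReal_mul,
        im_ofReal_mul]
  rw [norm_div, norm_mul, norm_zpow_sign hsgn, one_mul, norm_mexp, him, div_eq_mul_inv]
  refine mul_le_mul (le_of_eq ?_) ?_ (by positivity) (Real.exp_pos _).le
  · congr 1
    ring
  · exact inv_le_of_inv_le₀ (by norm_num) (by linarith)

lemma PhiS_sub {sgn : ℂ} (hsgn : sgn = 1 ∨ sgn = -1) {m : ℝ} (hm : 0 < m) (s : ℝ)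
    {τ : ℂ} (hτ : 0 < τ.im) {z₁ : ℂ} (z₂ : ℂ)
    (hz : ∀ a b : ℤ, z₁ ≠ (a : ℂ) + (b : ℂ) * τ) :
    PhiS sgn m s τ z₁ z₂ - PhiS sgn m (s + 1) τ z₁ z₂ =
      rExp m s τ ((z₁ - z₂) / 2) * ThetaS sgn s m τ (z₁ + z₂) := by
  rw [PhiS, PhiS, ← (summable_PhiS_term hsgn hm s hτ z₁ z₂).tsum_sub
    (summable_PhiS_term hsgn hm (s + 1) hτ z₁ z₂), ThetaS, ← tsum_mul_left]
  refine tsum_congr fun n => ?_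
  have hne : 1 - mexp (z₁ + n * τ) ≠ 0 := by
    refine sub_ne_zero.2 (mexp_ne_one fun a ha => hz a (-n) ?_).symm
    push_cast
    linear_combination ha
  have hmul : mexp ((m : ℂ) * n * (z₁ + z₂) + ((s + 1 : ℝ) : ℂ) * z₁ +
      τ * ((m : ℂ) * n ^ 2 + ((s + 1 : ℝ) : ℂ) * n)) =
      mexp ((m : ℂ) * n * (z₁ + z₂) + (s : ℂ) * z₁ + τ * ((m : ℂ) * n ^ 2 + (s : ℂ) * n)) *
        mexp (z₁ + n * τ) := by
    rw [← mexp_add]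
    congr 1
    push_cast
    ring
  rw [hmul, ← sub_div, div_eq_iff hne]
  have hsplit : mexp ((m : ℂ) * n * (z₁ + z₂) + (s : ℂ) * z₁ +
      τ * ((m : ℂ) * n ^ 2 + (s : ℂ) * n)) =
      rExp m s τ ((z₁ - z₂) / 2) *
        mexp ((m : ℂ) * (z₁ + z₂) * ((n : ℂ) + ((s / (2 * m) : ℝ) : ℂ)) +
          τ * (m : ℂ) * ((n : ℂ) + ((s / (2 * m) : ℝ) : ℂ)) ^ 2) := by
    rw [rExp, mexp, mexp, ← Complex.exp_add]
    congr 1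
    have : (m : ℂ) ≠ 0 := by exact_mod_cast hm.ne'
    push_cast
    field_simp
    ring
  rw [hsplit]
  ring

lemma PhiTilde_periodic {sgn : ℂ} (hsgn : sgn = 1 ∨ sgn = -1) {m : ℝ} {N : ℕ} (hN : 2 * m = N)
    (hN0 : 0 < N) {τ : ℂ} (hτ : 0 < τ.im) {z₁ : ℂ} (z₂ : ℂ)
    (hz : ∀ a b : ℤ, z₁ ≠ (a : ℂ) + (b : ℂ) * τ) :
    Function.Periodic (fun s => PhiTilde sgn m s τ z₁ z₂) 1 := fun s => by
  have hm : 0 < m := by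
    have : (0 : ℝ) < N := by exact_mod_cast hN0
    linarith
  simp only [PhiTilde]
  linear_combination (1 / 2) * PhiAddS_sub hsgn hN hN0 s hτ z₁ z₂ - PhiS_sub hsgn hm s hτ z₂ hz

end

/-- for `m = m2/2 ∈ (1/2)ℤ_{>0}` and `s = s2/2, s₁ = s12/2 ∈ (1/2)ℤ` with
`s - s₁ ∈ ℤ` (i.e. `s2 - s12` even), the modified functions `Φ̃^{±[m;s]}` and
`Φ̃^{±[m;s₁]}` coincide. -/
theorem stmt8 (m2 : ℤ) (hm2 : 0 < m2) (s2 s12 : ℤ) (h : Even (s2 - s12))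
    (sgn : ℂ) (hsgn : sgn = 1 ∨ sgn = -1)
    (τ z₁ z₂ : ℂ) (hτ : 0 < τ.im) (hz : ∀ a b : ℤ, z₁ ≠ (a : ℂ) + (b : ℂ) * τ) :
    PhiTilde sgn ((m2 : ℝ) / 2) ((s2 : ℝ) / 2) τ z₁ z₂ =
      PhiTilde sgn ((m2 : ℝ) / 2) ((s12 : ℝ) / 2) τ z₁ z₂ := by
  obtain ⟨d, hd⟩ := h
  have hN : 2 * ((m2 : ℝ) / 2) = (m2.toNat : ℝ) := by
    have : ((m2.toNat : ℤ) : ℝ) = m2 := by rw [Int.toNat_of_nonneg hm2.le]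
    rw [← this]
    push_cast
    ring
  have hper := (PhiTilde_periodic hsgn hN (by omega) hτ z₂ hz).int_mul d ((s12 : ℝ) / 2)
  have hs : (s2 : ℝ) / 2 = (s12 : ℝ) / 2 + d * 1 := by
    have : (s2 : ℝ) - s12 = d + d := by exact_mod_cast hd
    linarith
  rw [hs]
  exact hper
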